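/- Let x, y be nonnegative reals with x + y ≤ 1 and let s = 1 − x − y ≥ 0 denote a residual; consider g(x, y, s) = s·x·y / ((s + x)(y + x)) for the second-type Hardy bound with the roles |h11|² = s, |h12|² = x, ‖H22‖_F² = y. Then g ≤ (5√5 − 11)/2. -/

import Mathlib

theorem stmt_11 (x y s : ℝ) (hx : 0 ≤ x) (hy : 0 ≤ y) (hxy : x + y ≤ 1)
    (hs : s = 1 - x - y) (hsx : 0 < s + x) (hyx : 0 < y + x) :
    s * x * y / ((s + x) * (y + x)) ≤ (5 * Real.sqrt 5 - 11) / 2 := by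
  have hr2 : Real.sqrt 5 * Real.sqrt 5 = 5 := Real.mul_self_sqrt (by norm_num)
  have hr0 : 0 ≤ Real.sqrt 5 := Real.sqrt_nonneg 5
  generalize Real.sqrt 5 = r at *
  have hr : (11 : ℝ) / 5 ≤ r := by nlinarith
  have hs0 : 0 ≤ s := by linarith
  rw [div_le_iff₀ (mul_pos hsx hyx)]
  have hp : 0 ≤ s * y := mul_nonneg hs0 hy
  have hp4 : s * y ≤ (1 - x) ^ 2 / 4 := by
    have h1 : 1 - x = s + y := by linarith
    rw [h1]
    nlinarith [sq_nonneg (s - y)]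
  have e : (s + x) * (y + x) = s * y + x := by rw [hs]; ring
  rw [e]
  obtain ⟨c, hc⟩ : ∃ c, c = (5 * r - 11) / 2 := ⟨_, rfl⟩
  rw [← hc]
  have hc0 : 0 ≤ c := by rw [hc]; linarith
  have key : x * (1 - x) ^ 2 ≤ c * (1 + x) ^ 2 := by
    have h : c * (1 + x) ^ 2 - x * (1 - x) ^ 2 = (x - (r - 2)) ^ 2 * ((r + 1) / 2 - x) := by
      rw [hc]
      linear_combination (-(r / 2) + 3 / 2 + 2 * x) * hr2
    have : 0 ≤ (x - (r - 2)) ^ 2 * ((r + 1) / 2 - x) :=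
      mul_nonneg (sq_nonneg _) (by linarith)
    linarith
  rcases le_total x c with h | h
  · nlinarith [mul_nonneg hp (sub_nonneg.2 h), mul_nonneg hc0 hx]
  · nlinarith [mul_nonneg (sub_nonneg.2 hp4) (sub_nonneg.2 h)]
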